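/- arXiv:2304.04908 — 2 statements merged into one kernel-verified Lean document; each statement's English description precedes it below -/
import Mathlib

section
/- Let 1 ≤ l ≤ n−1 and i ∈ ℤ. Then the 2n × 2n matrix A(l,i) is nilpotent with A(l,i)^n = 0. -/
noncomputable section

namespace Radford

variable (𝕜 : Type) [Field 𝕜]

/-- The q-integer `(k)_q = 1 + q + ⋯ + q^(k-1)`. -/
def qInt (q : 𝕜) (k : ℕ) : 𝕜 := ∑ j ∈ Finset.range k, q ^ j

/-- The q-factorial `(k)!_q = (1)_q (2)_q ⋯ (k)_q`. -/
def qFact (q : 𝕜) : ℕ → 𝕜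
  | 0 => 1
  | k + 1 => qFact q k * qInt 𝕜 q (k + 1)

variable (m n : ℕ) (ξ : 𝕜)

/-- Generators of the free algebra: 0 ↦ a, 1 ↦ b, 2 ↦ c, 3 ↦ d. -/
def fgen (k : Fin 4) : FreeAlgebra 𝕜 (Fin 4) := FreeAlgebra.ι 𝕜 k

local notation "fa" => fgen 𝕜 0
local notation "fb" => fgen 𝕜 1
local notation "fc" => fgen 𝕜 2
local notation "fd" => fgen 𝕜 3

/-- The defining relations of the Drinfeld double `H_{mn}(ξ) = D(R_{mn}(q))`, where `q = ξ^m`. -/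
inductive HRel : FreeAlgebra 𝕜 (Fin 4) → FreeAlgebra 𝕜 (Fin 4) → Prop
  | aPow : HRel (fa ^ n) (fb ^ n - 1)
  | bPow : HRel (fb ^ (m * n)) 1
  | cPow : HRel (fc ^ (m * n)) 1
  | dPow : HRel (fd ^ n) 0
  | ab : HRel (fa * fb) (ξ ^ m • (fb * fa))
  | dc : HRel (fd * fc) (ξ • (fc * fd))
  | bc : HRel (fb * fc) (fc * fb)
  | bd : HRel (fb * fd) (ξ ^ m • (fd * fb))
  | ad : HRel (fa * fd - fd * fa) (fb - fc ^ m)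
  | ac : HRel (fa * fc)
      (ξ⁻¹ • (fc * fa) +
        ((ξ⁻¹ - ξ ^ (n - 1)) / qFact 𝕜 (ξ ^ m) (n - 1)) •
          ((fc ^ (m + 1) - ξ ^ m • (fb * fc)) * fd ^ (n - 1)))

/-- The Drinfeld double `H_{mn}(ξ)` of the Radford Hopf algebra `R_{mn}(q)`, presented by
generators `a, b, c, d` and the above relations. -/
def H := RingQuot (HRel 𝕜 m n ξ)

instance : Ring (H 𝕜 m n ξ) := inferInstanceAs (Ring (RingQuot (HRel 𝕜 m n ξ)))

instance : Algebra 𝕜 (H 𝕜 m n ξ) := inferInstanceAs (Algebra 𝕜 (RingQuot (HRel 𝕜 m n ξ)))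

/-- The generators `a, b, c, d` of `H_{mn}(ξ)` (indexed by 0,1,2,3). -/
def gen (k : Fin 4) : H 𝕜 m n ξ := RingQuot.mkAlgHom 𝕜 (HRel 𝕜 m n ξ) (fgen 𝕜 k)

local notation "ha" => gen 𝕜 m n ξ 0
local notation "hb" => gen 𝕜 m n ξ 1
local notation "hc" => gen 𝕜 m n ξ 2
local notation "hd" => gen 𝕜 m n ξ 3

/-- The Jacobson radical `J` of `H_{mn}(ξ)`. -/
def jrad : Ideal (H 𝕜 m n ξ) := Ideal.jacobson ⊥

/-- The scalars `α_k(l,i)`;  `alph l i k` is `α_k(l,i)`, where `q = ξ^m`. -/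
def alph (l : ℕ) (i : ℤ) (k : ℕ) : 𝕜 :=
  if k = n then ((ξ ^ m) ^ (i + (l : ℤ)) - (ξ ^ m) ^ i) / qFact 𝕜 (ξ ^ m) (n - 1)
  else qInt 𝕜 (ξ ^ m) k * ((ξ ^ m) ^ i - (ξ ^ m) ^ (i + (l : ℤ) - (k : ℤ)))

/-- The scalars `γ_k(l,i)`;  `gam l i k` is `γ_k(l,i)`, where `q = ξ^m`. -/
def gam (l : ℕ) (i : ℤ) (k : ℕ) : 𝕜 :=
  if k = n then ((ξ ^ m) ^ i - (ξ ^ m) ^ (i + (l : ℤ))) / qFact 𝕜 (ξ ^ m) (n - 1)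
  else qInt 𝕜 (ξ ^ m) k * ((ξ ^ m) ^ (i + (l : ℤ)) - (ξ ^ m) ^ (i - (k : ℤ)))

section ModuleH

variable {W : Type} [AddCommGroup W] [Module (H 𝕜 m n ξ) W]

variable (W) in
/-- The socle of an `H`-module: the sum of all simple submodules. -/
def socle : Submodule (H 𝕜 m n ξ) W :=
  sSup {N : Submodule (H 𝕜 m n ξ) W | IsSimpleModule (H 𝕜 m n ξ) N}

variable (W) in
/-- The submodule `J•W`, the radical of `W`. -/
def radM : Submodule (H 𝕜 m n ξ) W :=
  Submodule.span (H 𝕜 m n ξ) {x | ∃ r ∈ jrad 𝕜 m n ξ, ∃ w : W, x = r • w}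

variable (W) in
/-- The submodule `J²•W`. -/
def rad2M : Submodule (H 𝕜 m n ξ) W :=
  Submodule.span (H 𝕜 m n ξ)
    {x | ∃ r ∈ jrad 𝕜 m n ξ, ∃ s ∈ jrad 𝕜 m n ξ, ∃ w : W, x = r • s • w}

variable (W) in
/-- The submodule `J³•W`. -/
def rad3M : Submodule (H 𝕜 m n ξ) W :=
  Submodule.span (H 𝕜 m n ξ)
    {x | ∃ r ∈ jrad 𝕜 m n ξ, ∃ s ∈ jrad 𝕜 m n ξ, ∃ t ∈ jrad 𝕜 m n ξ, ∃ w : W, x = r • s • t • w}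

variable (W) in
/-- `lengthIs c W` : the `H`-module `W` has a composition series of length `c`
(hence, by Jordan–Hölder, has composition length `c`). -/
def lengthIs (c : ℕ) : Prop :=
  ∃ s : CompositionSeries (Submodule (H 𝕜 m n ξ) W), s.head = ⊥ ∧ s.last = ⊤ ∧ s.length = c

variable (W) in
/-- An `H`-module is indecomposable if it is nonzero and is not the direct sum of two
nonzero submodules. -/
def Indec : Prop :=
  Nontrivial W ∧ ∀ N₁ N₂ : Submodule (H 𝕜 m n ξ) W, IsCompl N₁ N₂ → N₁ = ⊥ ∨ N₂ = ⊥

variable (W) in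
/-- `W` has Loewy length 2: `J•W ≠ 0` and `J²•W = 0`. -/
def LoewyLen2 : Prop := radM 𝕜 m n ξ W ≠ ⊥ ∧ rad2M 𝕜 m n ξ W = ⊥

variable (W) in
/-- `W` is of `(s,t)`-type: it has Loewy length `2`, its socle has composition length `t`,
and `W/soc W` has composition length `s`. -/
def IsType (s t : ℕ) : Prop :=
  LoewyLen2 𝕜 m n ξ W ∧ lengthIs 𝕜 m n ξ (socle 𝕜 m n ξ W) t ∧
    lengthIs 𝕜 m n ξ (W ⧸ socle 𝕜 m n ξ W) s

end ModuleH

section ModuleK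

variable {V : Type} [AddCommGroup V] [Module 𝕜 V] [Module (H 𝕜 m n ξ) V]
  [IsScalarTower 𝕜 (H 𝕜 m n ξ) V]

variable (V) in
/-- `V^d = {v ∈ V | d•v = 0}`, as a `𝕜`-subspace. -/
def dKer : Submodule 𝕜 V where
  carrier := {v | hd • v = 0}
  add_mem' := by
    intro x y hx hy
    simp only [Set.mem_setOf_eq] at *
    rw [smul_add, hx, hy, add_zero]
  zero_mem' := smul_zero _
  smul_mem' := by
    intro r v hv
    simp only [Set.mem_setOf_eq] at *
    rw [smul_comm, hv, smul_zero]

variable (V) in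
/-- `V_{(i)} = {v ∈ V | c•v = ξ^i v}`, as a `𝕜`-subspace. -/
def eigsp (i : ℤ) : Submodule 𝕜 V where
  carrier := {v | hc • v = ξ ^ i • v}
  add_mem' := by
    intro x y hx hy
    simp only [Set.mem_setOf_eq] at *
    rw [smul_add, hx, hy, smul_add]
  zero_mem' := by simp
  smul_mem' := by
    intro r v hv
    simp only [Set.mem_setOf_eq] at *
    rw [smul_comm, hv, smul_comm]

/-- `V`, equipped with the family `mv : Fin l → V`, realizes the simple module `M(l,i)`:
`mv` is a basis of `V` and the generators act by the defining formulas of `M(l,i)`. -/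
def IsMrep (l : ℕ) (i : ℤ) (mv : Fin l → V) : Prop :=
  LinearIndependent 𝕜 mv ∧ Submodule.span 𝕜 (Set.range mv) = ⊤ ∧
  (∀ (j : ℕ) (hj : j + 1 < l),
    ha • mv ⟨j, by omega⟩ = alph 𝕜 m n ξ l i (j + 1) • mv ⟨j + 1, hj⟩) ∧
  (∀ (j : ℕ) (hj : j < l), j + 1 = l → ha • mv ⟨j, hj⟩ = 0) ∧
  (∀ j : Fin l, hb • mv j = ((ξ ^ m) ^ (i + (l : ℤ) - ((j : ℕ) + 1 : ℤ)) : 𝕜) • mv j) ∧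
  (∀ j : Fin l, hc • mv j = (ξ ^ (i + (j : ℕ) : ℤ) : 𝕜) • mv j) ∧
  (∀ (j : ℕ) (hj : j + 1 < l), hd • mv ⟨j + 1, hj⟩ = mv ⟨j, by omega⟩) ∧
  (∀ hl : 0 < l, hd • mv ⟨0, hl⟩ = 0)

/-- `V` realizes the induced module `Z(λ_{ij})`: there is a cyclic vector `z` with
`d•z = 0`, `b•z = ξ^j z`, `c•z = ξ^i z` such that `(a^k • z)_{0 ≤ k ≤ n-1}` is a basis. -/
def IsZrep (i j : ℤ) (V : Type) [AddCommGroup V] [Module 𝕜 V] [Module (H 𝕜 m n ξ) V]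
    [IsScalarTower 𝕜 (H 𝕜 m n ξ) V] : Prop :=
  ∃ z : V, hd • z = 0 ∧ hb • z = (ξ ^ j : 𝕜) • z ∧ hc • z = (ξ ^ i : 𝕜) • z ∧
    LinearIndependent 𝕜 (fun k : Fin n => (ha ^ (k : ℕ)) • z) ∧
    Submodule.span 𝕜 (Set.range fun k : Fin n => (ha ^ (k : ℕ)) • z) = ⊤

/-- `V`, equipped with the families `v u : Fin n → V`, realizes the projective module `P(l,i)`
with its standard basis. -/
def IsPrep (l : ℕ) (hl1 : 1 ≤ l) (hl2 : l < n) (i : ℤ) (v u : Fin n → V) : Prop :=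
  LinearIndependent 𝕜 (Sum.elim v u) ∧
  Submodule.span 𝕜 (Set.range v ∪ Set.range u) = ⊤ ∧
  (∀ (j : ℕ) (hj : j + l + 2 ≤ n),
    ha • v ⟨j, by omega⟩ = gam 𝕜 m n ξ l i (j + 1) • v ⟨j + 1, by omega⟩) ∧
  (∀ (j : ℕ) (hj : j + 1 < n), n ≤ j + 1 + l →
    ha • v ⟨j, by omega⟩ =
      gam 𝕜 m n ξ l i (j + 1) • v ⟨j + 1, hj⟩ + u ⟨j + 1 + l - n, by omega⟩) ∧
  (ha • v ⟨n - 1, by omega⟩ = gam 𝕜 m n ξ l i n • v ⟨0, by omega⟩ + u ⟨l, by omega⟩) ∧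
  (∀ (j : ℕ) (hj : j + 1 < n),
    ha • u ⟨j, by omega⟩ = alph 𝕜 m n ξ l i (j + 1) • u ⟨j + 1, hj⟩) ∧
  (ha • u ⟨n - 1, by omega⟩ = alph 𝕜 m n ξ l i n • u ⟨0, by omega⟩) ∧
  (∀ j : Fin n, hb • v j = ((ξ ^ m) ^ (i + (n : ℤ) - ((j : ℕ) + 1 : ℤ)) : 𝕜) • v j) ∧
  (∀ j : Fin n, hb • u j = ((ξ ^ m) ^ (i + (l : ℤ) - ((j : ℕ) + 1 : ℤ)) : 𝕜) • u j) ∧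
  (∀ j : Fin n, hc • v j = (ξ ^ (i - ((n : ℤ) - (l : ℤ)) + (j : ℕ) : ℤ) : 𝕜) • v j) ∧
  (∀ j : Fin n, hc • u j = (ξ ^ (i + (j : ℕ) : ℤ) : 𝕜) • u j) ∧
  (hd • v ⟨0, by omega⟩ = 0) ∧
  (∀ (j : ℕ) (hj : j + 1 < n), hd • v ⟨j + 1, hj⟩ = v ⟨j, by omega⟩) ∧
  (hd • u ⟨0, by omega⟩ = 0) ∧
  (∀ (j : ℕ) (hj : j + 1 < n), hd • u ⟨j + 1, hj⟩ = u ⟨j, by omega⟩)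

/-- `V`, equipped with the basis `e : Fin n → V`, realizes the module `T_1(l,i)`. -/
def IsT1rep (l : ℕ) (hl1 : 1 ≤ l) (hl2 : l < n) (i : ℤ) (e : Fin n → V) : Prop :=
  LinearIndependent 𝕜 e ∧ Submodule.span 𝕜 (Set.range e) = ⊤ ∧
  (∀ (j : ℕ) (hj : j + 1 < n),
    ha • e ⟨j, by omega⟩ = alph 𝕜 m n ξ l i (j + 1) • e ⟨j + 1, hj⟩) ∧
  (ha • e ⟨n - 1, by omega⟩ = alph 𝕜 m n ξ l i n • e ⟨0, by omega⟩) ∧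
  (∀ j : Fin n, hb • e j = ((ξ ^ m) ^ (i + (l : ℤ) - ((j : ℕ) + 1 : ℤ)) : 𝕜) • e j) ∧
  (∀ j : Fin n, hc • e j = (ξ ^ (i + (j : ℕ) : ℤ) : 𝕜) • e j) ∧
  (hd • e ⟨0, by omega⟩ = 0) ∧
  (∀ (j : ℕ) (hj : j + 1 < n), hd • e ⟨j + 1, hj⟩ = e ⟨j, by omega⟩)

/-- `V`, equipped with the basis `e : Fin n → V`, realizes the module `T̄_1(l,i)`. -/
def IsT1barrep (l : ℕ) (hl1 : 1 ≤ l) (hl2 : l < n) (i : ℤ) (e : Fin n → V) : Prop :=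
  LinearIndependent 𝕜 e ∧ Submodule.span 𝕜 (Set.range e) = ⊤ ∧
  (∀ (j : ℕ) (hj : j + 1 < n - l),
    ha • e ⟨j, by omega⟩ = alph 𝕜 m n ξ (n - l) (i + l - n) (j + 1) • e ⟨j + 1, by omega⟩) ∧
  (ha • e ⟨n - l - 1, by omega⟩ = e ⟨n - l, by omega⟩) ∧
  (∀ (k : ℕ) (hk : k + 1 < l),
    ha • e ⟨n - l + k, by omega⟩ = alph 𝕜 m n ξ l i (k + 1) • e ⟨n - l + k + 1, by omega⟩) ∧
  (ha • e ⟨n - 1, by omega⟩ = 0) ∧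
  (∀ j : Fin n, hb • e j = ((ξ ^ m) ^ (i - ((j : ℕ) + 1 : ℤ)) : 𝕜) • e j) ∧
  (∀ j : Fin n, hc • e j = (ξ ^ (i + (l : ℤ) - (n : ℤ) + (j : ℕ) : ℤ) : 𝕜) • e j) ∧
  (hd • e ⟨0, by omega⟩ = 0) ∧
  (∀ (j : ℕ) (hj : j + 1 < n - l), hd • e ⟨j + 1, by omega⟩ = e ⟨j, by omega⟩) ∧
  (hd • e ⟨n - l, by omega⟩ = 0) ∧
  (∀ (k : ℕ) (hk : k + 1 < l), hd • e ⟨n - l + k + 1, by omega⟩ = e ⟨n - l + k, by omega⟩)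

end ModuleK

section Matrices

/-- The nilpotent Jordan-type matrix `D_s` with `1` on the superdiagonal. -/
def Dmat (s : ℕ) : Matrix (Fin s) (Fin s) 𝕜 :=
  fun r c => if (r : ℕ) + 1 = (c : ℕ) then 1 else 0

/-- The matrix `X_{l,i}` : subdiagonal entries `γ_k(l,i)`, `(1,n)`-entry `γ_n(l,i)`. -/
def Xmat (l : ℕ) (i : ℤ) : Matrix (Fin n) (Fin n) 𝕜 := fun r c =>
  if (r : ℕ) = (c : ℕ) + 1 then gam 𝕜 m n ξ l i ((c : ℕ) + 1)
  else if (r : ℕ) = 0 ∧ (c : ℕ) = n - 1 then gam 𝕜 m n ξ l i n else 0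

/-- The matrix `Z_{l,i}` : subdiagonal entries `α_k(l,i)`, `(1,n)`-entry `α_n(l,i)`. -/
def Zmat (l : ℕ) (i : ℤ) : Matrix (Fin n) (Fin n) 𝕜 := fun r c =>
  if (r : ℕ) = (c : ℕ) + 1 then alph 𝕜 m n ξ l i ((c : ℕ) + 1)
  else if (r : ℕ) = 0 ∧ (c : ℕ) = n - 1 then alph 𝕜 m n ξ l i n else 0

/-- The block matrix `A(l,i) = [[X_{l,i}, 0], [D_n^{n-l-1}, Z_{l,i}]]`. -/
def Amat (l : ℕ) (i : ℤ) : Matrix (Fin n ⊕ Fin n) (Fin n ⊕ Fin n) 𝕜 :=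
  Matrix.fromBlocks (Xmat 𝕜 m n ξ l i) 0 (Dmat 𝕜 n ^ (n - l - 1)) (Zmat 𝕜 m n ξ l i)

/-- The diagonal matrix `B(l,i)`. -/
def Bmat (l : ℕ) (i : ℤ) : Matrix (Fin n ⊕ Fin n) (Fin n ⊕ Fin n) 𝕜 :=
  Matrix.fromBlocks
    (Matrix.diagonal fun j : Fin n => (ξ ^ m) ^ (i - ((j : ℕ) + 1 : ℤ))) 0 0
    (Matrix.diagonal fun j : Fin n => (ξ ^ m) ^ (i + (l : ℤ) - ((j : ℕ) + 1 : ℤ)))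

/-- The diagonal matrix `C(l,i)`. -/
def Cmat (l : ℕ) (i : ℤ) : Matrix (Fin n ⊕ Fin n) (Fin n ⊕ Fin n) 𝕜 :=
  Matrix.fromBlocks
    (Matrix.diagonal fun j : Fin n => ξ ^ (i + (l : ℤ) - (n : ℤ) + (j : ℕ))) 0 0
    (Matrix.diagonal fun j : Fin n => ξ ^ (i + (j : ℕ) : ℤ))

/-- The block matrix `D = diag(D_n, D_n)`. -/
def Dbig : Matrix (Fin n ⊕ Fin n) (Fin n ⊕ Fin n) 𝕜 :=
  Matrix.fromBlocks (Dmat 𝕜 n) 0 0 (Dmat 𝕜 n)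

end Matrices


/-- The shape of the action of `a` on `P(l,i)` that makes the `n`-th power of `f` vanish on every
basis vector. -/
theorem pow_apply_eq_zero_of_cyclic_action {R V : Type*} [CommRing R] [AddCommGroup V] [Module R V]
    (f : Module.End R V) (n l : ℕ) (hl : 1 ≤ l) (hln : l < n) (v u : ℕ → V) (α γ : ℕ → R)
    (hαl : α l = 0) (hγ : γ (n - l) = 0) (hαγn : α n + γ n = 0)
    (hαγ : ∀ t, 1 ≤ t → l + t < n → α (l + t) = γ t)
    (hu : ∀ j, j + 1 < n → f (u j) = α (j + 1) • u (j + 1))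
    (hulast : f (u (n - 1)) = α n • u 0)
    (hv₁ : ∀ j, j + 1 + l < n → f (v j) = γ (j + 1) • v (j + 1))
    (hv₂ : ∀ j, j + 1 < n → n ≤ j + 1 + l → f (v j) = γ (j + 1) • v (j + 1) + u (j + 1 + l - n))
    (hvlast : f (v (n - 1)) = γ n • v 0 + u l) (j : ℕ) (hj : j < n) :
    (f ^ n) (v j) = 0 ∧ (f ^ n) (u j) = 0 := by
  have mono : ∀ {a b : ℕ} {x : V}, (f ^ a) x = 0 → a ≤ b → (f ^ b) x = 0 := by
    intro a b x hx hab
    obtain ⟨c, rfl⟩ := Nat.exists_eq_add_of_le' hab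
    rw [pow_add, Module.End.mul_apply, hx, map_zero]
  have step : ∀ (a : ℕ) (x : V), (f ^ (a + 1)) x = (f ^ a) (f x) := fun a x => by
    rw [pow_succ, Module.End.mul_apply]
  have u_low : ∀ k j, j + k + 1 = l → (f ^ (k + 1)) (u j) = 0 := by
    intro k
    induction k with
    | zero => intro j h; rw [step, hu j (by omega), show j + 1 = l by omega, hαl]; simp
    | succ k ih =>
      intro j h
      rw [step, hu j (by omega), map_smul, ih (j + 1) (by omega), smul_zero]
  have u_high : ∀ k j, j + k + 1 = n → (f ^ (k + 1 + l)) (u j) = 0 := by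
    intro k
    induction k with
    | zero =>
      intro j h
      rw [show 0 + 1 + l = l + 1 by omega, step, show j = n - 1 by omega, hulast, map_smul,
        mono (u_low (l - 1) 0 (by omega)) (by omega), smul_zero]
    | succ k ih =>
      intro j h
      rw [show k + 1 + 1 + l = k + 1 + l + 1 by omega, step, hu j (by omega), map_smul,
        ih (j + 1) (by omega), smul_zero]
  have v_low : ∀ k j, j + k + 1 + l = n → (f ^ (k + l + 1)) (v j) = 0 := by
    intro k
    induction k with
    | zero =>
      intro j h
      rw [step, hv₂ j (by omega) (by omega), show j + 1 = n - l by omega, hγ, zero_smul, zero_add (u _),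
        show n - l + l - n = 0 by omega]
      exact mono (u_low (l - 1) 0 (by omega)) (by omega)
    | succ k ih =>
      intro j h
      rw [step, hv₁ j (by omega), map_smul, show k + 1 + l = k + l + 1 by omega,
        ih (j + 1) (by omega), smul_zero]
  have mixed : ∀ k j, j + k + 1 + l = n → (f ^ (k + 1)) (γ n • v j + u (l + j)) = 0 := by
    intro k
    induction k with
    | zero =>
      intro j h
      rw [step, map_add, map_smul, hv₂ j (by omega) (by omega), show l + j = n - 1 by omega, hulast,
        show j + 1 = n - l by omega, hγ, zero_smul, zero_add, show n - l + l - n = 0 by omega,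
        ← add_smul, add_comm, hαγn, zero_smul, map_zero]
    | succ k ih =>
      intro j h
      rw [step, map_add, map_smul, hv₁ j (by omega), hu (l + j) (by omega), add_assoc,
        hαγ (j + 1) (by omega) (by omega), smul_comm, ← smul_add, map_smul, ih (j + 1) (by omega),
        smul_zero]
  have v_high : ∀ k j, j + k + 1 = n → n ≤ j + l → (f ^ (k + 1 + (n - l))) (v j) = 0 := by
    intro k
    induction k with
    | zero =>
      intro j h _
      rw [show 0 + 1 + (n - l) = n - l + 1 by omega, step, show j = n - 1 by omega, hvlast]
      exact mono (mixed (n - l - 1) 0 (by omega)) (by omega)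
    | succ k ih =>
      intro j h h'
      rw [show k + 1 + 1 + (n - l) = k + 1 + (n - l) + 1 by omega, step,
        hv₂ j (by omega) (by omega), map_add, map_smul, ih (j + 1) (by omega) (by omega),
        mono (u_low k _ (by omega)) (by omega), smul_zero, zero_add]
  constructor
  · by_cases h : j + l < n
    · exact mono (v_low (n - l - 1 - j) j (by omega)) (by omega)
    · exact mono (v_high (n - 1 - j) j (by omega) (by omega)) (by omega)
  · by_cases h : j < l
    · exact mono (u_low (l - 1 - j) j (by omega)) (by omega)
    · exact mono (u_high (n - 1 - j) j (by omega)) (by omega)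

theorem Dmat_pow_apply (𝕜 : Type) [Field 𝕜] (s k : ℕ) (r c : Fin s) :
    (Dmat 𝕜 s ^ k) r c = if (r : ℕ) + k = c then 1 else 0 := by
  induction k generalizing r with
  | zero => simp [Matrix.one_apply, Fin.ext_iff]
  | succ k ih =>
    rw [pow_succ', Matrix.mul_apply]
    simp only [ih, Dmat, ite_mul, one_mul, zero_mul]
    by_cases h : (r : ℕ) + 1 < s
    · rw [Finset.sum_eq_single ⟨r + 1, h⟩]
      · simp [add_assoc, add_comm 1 k]
      · intro b _ hne
        have : (r : ℕ) + 1 ≠ b := fun h' => hne (Fin.ext h'.symm)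
        rw [if_neg this]
      · simp
    · rw [if_neg (by omega)]
      exact Finset.sum_eq_zero fun b _ => if_neg (by omega)

theorem alph_add_eq_gam (𝕜 : Type) [Field 𝕜] (m n : ℕ) (ξ : 𝕜) (hq0 : ξ ^ m ≠ 0)
    (hq1 : ξ ^ m ≠ 1) (l : ℕ) (i : ℤ) (t : ℕ) (ht : l + t < n) (hl : 1 ≤ l) :
    alph 𝕜 m n ξ l i (l + t) = gam 𝕜 m n ξ l i t := by
  rw [alph, gam, if_neg (by omega), if_neg (by omega)]
  generalize ξ ^ m = q at *
  simp only [qInt]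
  apply mul_left_cancel₀ (sub_ne_zero.2 hq1)
  rw [← mul_assoc, ← mul_assoc, mul_geom_sum, mul_geom_sum]
  rw [show i + (l : ℤ) - ((l + t : ℕ) : ℤ) = i - t by push_cast; ring, zpow_sub₀ hq0,
    zpow_add₀ hq0, zpow_natCast, zpow_natCast, pow_add]
  field_simp

/-- the matrix `A(l,i)` is nilpotent with `A(l,i)^n = 0`. -/
theorem statement1 (𝕜 : Type) [Field 𝕜] [IsAlgClosed 𝕜] (m n : ℕ) (hm : 1 < m) (hn : 1 < n)
    (ξ : 𝕜) (hξ : IsPrimitiveRoot ξ (m * n))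
    (l : ℕ) (hl1 : 1 ≤ l) (hl2 : l ≤ n - 1) (i : ℤ) :
    Amat 𝕜 m n ξ l i ^ n = 0 := by
  have hq : IsPrimitiveRoot (ξ ^ m) n := hξ.pow (by positivity) rfl
  have hq0 : ξ ^ m ≠ 0 := hq.ne_zero (by omega)
  have hq1 : ξ ^ m ≠ 1 := hq.ne_one hn
  let v : ℕ → Fin n ⊕ Fin n → 𝕜 := fun j => Sum.elim (fun r => if (r : ℕ) = j then 1 else 0) 0
  let u : ℕ → Fin n ⊕ Fin n → 𝕜 := fun j => Sum.elim 0 (fun r => if (r : ℕ) = j then 1 else 0)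
  have v_eq : ∀ j : Fin n, v j = Pi.single (Sum.inl j) 1 := by
    intro j; ext (r | r) <;> simp [v, Pi.single_apply, Fin.ext_iff]
  have u_eq : ∀ j : Fin n, u j = Pi.single (Sum.inr j) 1 := by
    intro j; ext (r | r) <;> simp [u, Pi.single_apply, Fin.ext_iff]
  have Av : ∀ j : Fin n, Matrix.toLin' (Amat 𝕜 m n ξ l i) (v j) =
      Sum.elim (fun r => Xmat 𝕜 m n ξ l i r j) (fun r => (Dmat 𝕜 n ^ (n - l - 1)) r j) := by
    intro j; rw [v_eq]; ext (r | r) <;> simp [Amat]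
  have Au : ∀ j : Fin n, Matrix.toLin' (Amat 𝕜 m n ξ l i) (u j) =
      Sum.elim (0 : Fin n → 𝕜) (fun r => Zmat 𝕜 m n ξ l i r j) := by
    intro j; rw [u_eq]; ext (r | r) <;> simp [Amat]
  have key := pow_apply_eq_zero_of_cyclic_action (Matrix.toLin' (Amat 𝕜 m n ξ l i)) n l hl1
    (by omega) v u (alph 𝕜 m n ξ l i) (gam 𝕜 m n ξ l i)
    (by rw [alph, if_neg (by omega)]; simp)
    (by
      rw [gam, if_neg (by omega), Nat.cast_sub (by omega),
        show i - ((n : ℤ) - l) = i + l - n by ring, zpow_sub₀ hq0, zpow_natCast, hq.pow_eq_one]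
      simp)
    (by rw [alph, gam, if_pos rfl, if_pos rfl]; ring)
    (fun t _ ht => alph_add_eq_gam 𝕜 m n ξ hq0 hq1 l i t ht hl1)
    (by
      intro j hj
      rw [Au ⟨j, by omega⟩]
      ext (r | r)
      · simp [u]
      · simp only [Sum.elim_inr, Zmat, u, Pi.smul_apply, smul_eq_mul]
        split_ifs <;> first | omega | simp)
    (by
      rw [Au ⟨n - 1, by omega⟩]
      ext (r | r)
      · simp [u]
      · simp only [Sum.elim_inr, Zmat, u, Pi.smul_apply, smul_eq_mul, and_true]
        split_ifs <;> first | omega | simp)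
    (by
      intro j hj
      rw [Av ⟨j, by omega⟩]
      ext (r | r)
      · simp only [Sum.elim_inl, Xmat, v, Pi.smul_apply, smul_eq_mul]
        split_ifs <;> first | omega | simp
      · simp only [Sum.elim_inr, Dmat_pow_apply, v, Pi.smul_apply, Pi.zero_apply, smul_zero]
        split_ifs <;> first | omega | simp)
    (by
      intro j hj hj'
      rw [Av ⟨j, by omega⟩]
      ext (r | r)
      · simp only [Sum.elim_inl, Xmat, v, u, Pi.add_apply, Pi.smul_apply, smul_eq_mul,
          Pi.zero_apply]
        split_ifs <;> first | omega | simp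
      · simp only [Sum.elim_inr, Dmat_pow_apply, v, u, Pi.add_apply, Pi.smul_apply, Pi.zero_apply,
          smul_zero]
        split_ifs <;> first | omega | simp)
    (by
      rw [Av ⟨n - 1, by omega⟩]
      ext (r | r)
      · simp only [Sum.elim_inl, Xmat, v, u, Pi.add_apply, Pi.smul_apply, smul_eq_mul,
          Pi.zero_apply, and_true]
        split_ifs <;> first | omega | simp
      · simp only [Sum.elim_inr, Dmat_pow_apply, v, u, Pi.add_apply, Pi.smul_apply, Pi.zero_apply,
          smul_zero]
        split_ifs <;> first | omega | simp)
  apply Matrix.toLin'.injective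
  rw [Matrix.toLin'_pow, map_zero]
  refine (Pi.basisFun 𝕜 (Fin n ⊕ Fin n)).ext ?_
  rintro (j | j)
  · simpa [v_eq] using (key j j.2).1
  · simpa [u_eq] using (key j j.2).2

end Radford
end
end

section
/- Let 1 ≤ l, l′ ≤ n−1 and i, i′ ∈ ℤ. Then: (1) M(l,i) is a simple H_{mn}(ξ)-module; (2) M(l,i) ≅ M(l′,i′) if and only if l = l′ and i ≡ i′ (mod mn); (3) M(l, i+kn) is not isomorphic to M(n−l, i+l+k′n) for any k, k′ ∈ ℤ. -/
noncomputable section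

namespace Radford

variable (𝕜 : Type) [Field 𝕜]

variable (m n : ℕ) (ξ : 𝕜)

local notation "fa" => fgen 𝕜 0
local notation "fb" => fgen 𝕜 1
local notation "fc" => fgen 𝕜 2
local notation "fd" => fgen 𝕜 3

local notation "ha" => gen 𝕜 m n ξ 0
local notation "hb" => gen 𝕜 m n ξ 1
local notation "hc" => gen 𝕜 m n ξ 2
local notation "hd" => gen 𝕜 m n ξ 3

section Acting

variable {𝕜 m n ξ}

variable {V W : Type} [AddCommGroup V] [Module 𝕜 V] [Module (H 𝕜 m n ξ) V]

theorem IsMrep.congr_modEq (hξ : IsPrimitiveRoot ξ (m * n)) (h0 : ξ ≠ 0) {l : ℕ} {i i' : ℤ}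
    (hi : Int.ModEq ((m : ℤ) * n) i i') {mv : Fin l → V} (h : IsMrep 𝕜 m n ξ l i mv) :
    IsMrep 𝕜 m n ξ l i' mv := by
  have e : ξ ^ i = ξ ^ i' := by
    have h1 : ξ ^ (i' - i) = 1 := by
      rw [hξ.zpow_eq_one_iff_dvd]
      push_cast
      exact hi.dvd
    rw [zpow_sub₀ h0, div_eq_one_iff_eq (zpow_ne_zero _ h0)] at h1
    exact h1.symm
  have eq : (ξ ^ m) ^ i = (ξ ^ m) ^ i' := by
    rw [← zpow_natCast ξ m, ← zpow_mul, ← zpow_mul, mul_comm, zpow_mul, e, ← zpow_mul, mul_comm,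
      zpow_mul]
  have hq : ξ ^ m ≠ 0 := pow_ne_zero _ h0
  have hα (k : ℕ) : alph 𝕜 m n ξ l i k = alph 𝕜 m n ξ l i' k := by
    simp only [alph, add_sub_assoc, zpow_add₀ hq, eq]
  obtain ⟨h1, h2, h3, h4, h5, h6, h7, h8⟩ := h
  refine ⟨h1, h2, fun j hj => ?_, h4, fun j => ?_, fun j => ?_, h7, h8⟩
  · rw [← hα, h3 j hj]
  · rw [h5 j, add_sub_assoc, add_sub_assoc, zpow_add₀ hq, zpow_add₀ hq, eq]
  · rw [h6 j, zpow_add₀ h0, zpow_add₀ h0, e]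

variable [IsScalarTower 𝕜 (H 𝕜 m n ξ) V] [AddCommGroup W] [Module 𝕜 W] [Module (H 𝕜 m n ξ) W]
  [IsScalarTower 𝕜 (H 𝕜 m n ξ) W]

theorem gen_d_pow : hd ^ n = 0 := by
  have h := RingQuot.mkAlgHom_rel 𝕜 (HRel.dPow (𝕜 := 𝕜) (m := m) (n := n) (ξ := ξ))
  rw [map_pow, map_zero] at h
  exact h

/-- A `𝕜`-linear map commuting with the generators commutes with all of `H_{mn}(ξ)`. -/
theorem map_smul_of_map_gen_smul (f : V →ₗ[𝕜] W)
    (hf : ∀ (k : Fin 4) (v : V), f (gen 𝕜 m n ξ k • v) = gen 𝕜 m n ξ k • f v)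
    (h : H 𝕜 m n ξ) (v : V) : f (h • v) = h • f v := by
  obtain ⟨x, rfl⟩ : ∃ x, (RingQuot.mkAlgHom 𝕜 (HRel 𝕜 m n ξ) x : H 𝕜 m n ξ) = h :=
    RingQuot.mkAlgHom_surjective 𝕜 (HRel 𝕜 m n ξ) h
  let φ : FreeAlgebra 𝕜 (Fin 4) →ₐ[𝕜] H 𝕜 m n ξ := RingQuot.mkAlgHom 𝕜 (HRel 𝕜 m n ξ)
  change f (φ x • v) = φ x • f v
  induction x using FreeAlgebra.induction generalizing v with
  | grade0 r => rw [AlgHom.commutes, algebraMap_smul, algebraMap_smul, map_smul]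
  | grade1 k => exact hf k v
  | mul x y hx hy => rw [map_mul, mul_smul, mul_smul, hx, hy]
  | add x y hx hy => rw [map_add, add_smul, add_smul, map_add, hx, hy]

theorem IsMrep.nonempty_equiv {l : ℕ} {i : ℤ} {mv : Fin l → V} {mw : Fin l → W}
    (hV : IsMrep 𝕜 m n ξ l i mv) (hW : IsMrep 𝕜 m n ξ l i mw) :
    Nonempty (V ≃ₗ[H 𝕜 m n ξ] W) := by
  obtain ⟨v1, v2, v3, v4, v5, v6, v7, v8⟩ := hV
  obtain ⟨w1, w2, w3, w4, w5, w6, w7, w8⟩ := hW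
  let f : V ≃ₗ[𝕜] W :=
    (Module.Basis.mk v1 v2.ge).equiv (Module.Basis.mk w1 w2.ge) (Equiv.refl _)
  have hf (j : Fin l) : f (mv j) = mw j := by
    have h := (Module.Basis.mk v1 v2.ge).equiv_apply j (Module.Basis.mk w1 w2.ge) (Equiv.refl _)
    simpa using h
  have hgen (k : Fin 4) (v : V) : f (gen 𝕜 m n ξ k • v) = gen 𝕜 m n ξ k • f v := by
    have hv : v ∈ Submodule.span 𝕜 (Set.range mv) := v2 ▸ Submodule.mem_top
    induction hv using Submodule.span_induction with
    | zero => simp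
    | add x y _ _ hx hy => simp only [smul_add, map_add, hx, hy]
    | smul r x _ hx => rw [smul_comm, map_smul, hx, map_smul, smul_comm]
    | mem x hx =>
      obtain ⟨⟨j, hj⟩, rfl⟩ := hx
      fin_cases k
      · by_cases hjl : j + 1 < l
        · simp [v3 j hjl, w3 j hjl, hf]
        · simp [v4 j hj (by omega), w4 j hj (by omega), hf]
      · simp [v5, w5, hf]
      · simp [v6, w6, hf]
      · cases j with
        | zero => simp [v8 hj, w8 hj, hf]
        | succ j => simp [v7 j hj, w7 j hj, hf]
  exact ⟨{ f with map_smul' := map_smul_of_map_gen_smul f.toLinearMap hgen }⟩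

/-- The kernel of `d` on `M(l,i)` is spanned by the first basis vector. -/
theorem IsMrep.exists_eq_smul_of_d_smul_eq_zero {l : ℕ} (hl : 0 < l) {i : ℤ} {mv : Fin l → V}
    (h : IsMrep 𝕜 m n ξ l i mv) {v : V} (hv : hd • v = 0) : ∃ x : 𝕜, v = x • mv ⟨0, hl⟩ := by
  obtain ⟨h1, h2, -, -, -, -, h7, h8⟩ := h
  obtain ⟨l, rfl⟩ : ∃ p, l = p + 1 := ⟨l - 1, by omega⟩
  obtain ⟨x, rfl⟩ := (Submodule.mem_span_range_iff_exists_fun 𝕜).1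
    (h2 ▸ Submodule.mem_top : v ∈ Submodule.span 𝕜 (Set.range mv))
  have hsum : ∑ j : Fin l, x j.succ • mv j.castSucc = 0 := by
    rw [Fin.sum_univ_succ, smul_add, smul_comm, Finset.smul_sum] at hv
    rw [← hv, show hd • mv 0 = 0 from h8 hl, smul_zero, zero_add]
    refine Finset.sum_congr rfl fun j _ => ?_
    rw [smul_comm]
    exact congrArg _ (h7 j (by omega)).symm
  have hx := Fintype.linearIndependent_iff.1 (h1.comp _ (Fin.castSucc_injective l)) _ hsum
  refine ⟨x 0, ?_⟩
  rw [Fin.sum_univ_succ]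
  simp [hx]

theorem pow_ne_one_of_lt (hξ : IsPrimitiveRoot ξ (m * n)) (hm : 0 < m) (hn : 0 < n) {k : ℕ}
    (hk : 0 < k) (hkn : k < n) : (ξ ^ m) ^ k ≠ 1 :=
  (hξ.pow (Nat.mul_pos hm hn) rfl).pow_ne_one_of_pos_of_lt hk.ne' hkn

theorem alph_ne_zero (hξ : IsPrimitiveRoot ξ (m * n)) (hm : 0 < m) {l : ℕ} (hln : l < n) (i : ℤ)
    {k : ℕ} (hk : 0 < k) (hkl : k < l) : alph 𝕜 m n ξ l i k ≠ 0 := by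
  have hn : 0 < n := by omega
  have hq : ξ ^ m ≠ 0 := pow_ne_zero _ (hξ.ne_zero (Nat.mul_pos hm hn).ne')
  rw [alph, if_neg (by omega)]
  refine mul_ne_zero (fun h => ?_) (fun h => ?_)
  · refine pow_ne_one_of_lt hξ hm hn hk (by omega) ?_
    rw [← sub_eq_zero, ← geom_sum_mul, ← qInt, h, zero_mul]
  · refine pow_ne_one_of_lt hξ hm hn (k := l - k) (by omega) (by omega) ?_
    rw [show i + (l : ℤ) - k = i + ((l - k : ℕ) : ℤ) by omega, zpow_add₀ hq, zpow_natCast,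
      sub_eq_zero] at h
    exact (mul_eq_left₀ (zpow_ne_zero i hq)).1 h.symm

theorem IsMrep.isSimpleModule (hξ : IsPrimitiveRoot ξ (m * n)) (hm : 0 < m) {l : ℕ} (hl : 0 < l)
    (hln : l < n) {i : ℤ} {mv : Fin l → V} (h : IsMrep 𝕜 m n ξ l i mv) :
    IsSimpleModule (H 𝕜 m n ξ) V := by
  have hspan (N : Submodule (H 𝕜 m n ξ) V) (hN : mv ⟨0, hl⟩ ∈ N) : N = ⊤ := by
    have hmem : ∀ (j : ℕ) (hj : j < l), mv ⟨j, hj⟩ ∈ N := by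
      intro j
      induction j with
      | zero => exact fun _ => hN
      | succ j ih =>
        intro hj
        have h1 := N.smul_mem ha (ih (by omega))
        rw [h.2.2.1 j hj] at h1
        exact (Submodule.smul_mem_iff (N.restrictScalars 𝕜)
          (alph_ne_zero hξ hm hln i j.succ_pos hj)).1 h1
    have hle : Submodule.span 𝕜 (Set.range mv) ≤ N.restrictScalars 𝕜 := by
      rw [Submodule.span_le]
      rintro _ ⟨j, rfl⟩
      exact hmem j j.2
    rw [h.2.1] at hle
    exact eq_top_iff.2 fun v _ => hle Submodule.mem_top
  have : Nontrivial V := ⟨mv ⟨0, hl⟩, 0, h.1.ne_zero _⟩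
  rw [isSimpleModule_iff]
  refine { exists_pair_ne := exists_pair_ne _, eq_bot_or_eq_top := fun N => ?_ }
  refine or_iff_not_imp_left.2 fun hN => hspan N ?_
  obtain ⟨v, hvN, hv⟩ := N.exists_mem_ne_zero_of_ne_bot hN
  have hex : ∃ k, hd ^ k • v = 0 := ⟨n, by rw [gen_d_pow, zero_smul]⟩
  classical
  obtain ⟨k, hk, hmin⟩ : ∃ k, hd ^ (k + 1) • v = 0 ∧ hd ^ k • v ≠ 0 := by
    have hpos : Nat.find hex ≠ 0 := fun h0 => hv (by
      have h1 := Nat.find_spec hex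
      rwa [h0, pow_zero, one_smul] at h1)
    refine ⟨Nat.find hex - 1, ?_, Nat.find_min hex (by omega)⟩
    rw [Nat.sub_add_cancel (by omega)]
    exact Nat.find_spec hex
  rw [pow_succ', mul_smul] at hk
  obtain ⟨x, hx⟩ := h.exists_eq_smul_of_d_smul_eq_zero hl hk
  have hmem : x • mv ⟨0, hl⟩ ∈ N := hx ▸ N.smul_mem _ hvN
  have hx0 : x ≠ 0 := by
    rintro rfl
    exact hmin (by rw [hx, zero_smul])
  exact (Submodule.smul_mem_iff (N.restrictScalars 𝕜) hx0).1 hmem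

theorem IsMrep.eq_and_modEq_of_equiv (hξ : IsPrimitiveRoot ξ (m * n)) (h0 : ξ ≠ 0) {l l' : ℕ}
    (hl : 0 < l) (hl' : 0 < l') {i i' : ℤ} {mv : Fin l → V} {mw : Fin l' → W}
    (hV : IsMrep 𝕜 m n ξ l i mv) (hW : IsMrep 𝕜 m n ξ l' i' mw) (f : V ≃ₗ[H 𝕜 m n ξ] W) :
    l = l' ∧ Int.ModEq ((m : ℤ) * n) i i' := by
  constructor
  · have hrank := (f.restrictScalars 𝕜).finrank_eq
    rwa [Module.finrank_eq_card_basis (Module.Basis.mk hV.1 hV.2.1.ge),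
      Module.finrank_eq_card_basis (Module.Basis.mk hW.1 hW.2.1.ge), Fintype.card_fin,
      Fintype.card_fin] at hrank
  · have hd0 : hd • f (mv ⟨0, hl⟩) = 0 := by
      rw [← map_smul, hV.2.2.2.2.2.2.2 hl, map_zero]
    obtain ⟨x, hx⟩ := hW.exists_eq_smul_of_d_smul_eq_zero hl' hd0
    have hne : f (mv ⟨0, hl⟩) ≠ 0 := f.map_ne_zero_iff.2 (hV.1.ne_zero _)
    have hcV : hc • f (mv ⟨0, hl⟩) = ξ ^ i • f (mv ⟨0, hl⟩) := by
      rw [← map_smul, hV.2.2.2.2.2.1, Nat.cast_zero, add_zero]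
      exact (f.restrictScalars 𝕜).map_smul (ξ ^ i) (mv ⟨0, hl⟩)
    have hcW : hc • f (mv ⟨0, hl⟩) = ξ ^ i' • f (mv ⟨0, hl⟩) := by
      rw [hx, smul_comm, hW.2.2.2.2.2.1, smul_comm]
      simp
    have e : ξ ^ i = ξ ^ i' := smul_left_injective 𝕜 hne (hcV.symm.trans hcW)
    have h1 : ξ ^ (i' - i) = 1 := by
      rw [zpow_sub₀ h0, e, div_self (zpow_ne_zero _ h0)]
    rw [hξ.zpow_eq_one_iff_dvd] at h1
    push_cast at h1
    exact Int.modEq_iff_dvd.2 h1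

end Acting

/-- Lemma 3.2: simplicity and isomorphism classification of the modules
`M(l,i)`, encoded via the predicate `IsMrep` ("has a standard basis of `M(l,i)`"). -/
theorem statement3 (𝕜 : Type) [Field 𝕜] [IsAlgClosed 𝕜] (m n : ℕ) (hm : 1 < m) (hn : 1 < n)
    (ξ : 𝕜) (hξ : IsPrimitiveRoot ξ (m * n))
    (l l' : ℕ) (hl : 1 ≤ l ∧ l ≤ n - 1) (hl' : 1 ≤ l' ∧ l' ≤ n - 1) (i i' : ℤ) :
    (∀ (V : Type) [AddCommGroup V] [Module 𝕜 V] [Module (H 𝕜 m n ξ) V]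
        [IsScalarTower 𝕜 (H 𝕜 m n ξ) V] (mv : Fin l → V),
      IsMrep 𝕜 m n ξ l i mv → IsSimpleModule (H 𝕜 m n ξ) V) ∧
    (∀ (V W : Type) [AddCommGroup V] [Module 𝕜 V] [Module (H 𝕜 m n ξ) V]
        [IsScalarTower 𝕜 (H 𝕜 m n ξ) V] [AddCommGroup W] [Module 𝕜 W] [Module (H 𝕜 m n ξ) W]
        [IsScalarTower 𝕜 (H 𝕜 m n ξ) W] (mv : Fin l → V) (mw : Fin l' → W),
      IsMrep 𝕜 m n ξ l i mv → IsMrep 𝕜 m n ξ l' i' mw →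
      (Nonempty (V ≃ₗ[H 𝕜 m n ξ] W) ↔ l = l' ∧ Int.ModEq ((m : ℤ) * n) i i')) ∧
    (∀ (k k' : ℤ) (V W : Type) [AddCommGroup V] [Module 𝕜 V] [Module (H 𝕜 m n ξ) V]
        [IsScalarTower 𝕜 (H 𝕜 m n ξ) V] [AddCommGroup W] [Module 𝕜 W] [Module (H 𝕜 m n ξ) W]
        [IsScalarTower 𝕜 (H 𝕜 m n ξ) W] (mv : Fin l → V) (mw : Fin (n - l) → W),
      IsMrep 𝕜 m n ξ l (i + k * n) mv → IsMrep 𝕜 m n ξ (n - l) (i + l + k' * n) mw →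
      ¬ Nonempty (V ≃ₗ[H 𝕜 m n ξ] W)) := by
  have h0 : ξ ≠ 0 := hξ.ne_zero (by positivity)
  refine ⟨fun V _ _ _ _ mv h => h.isSimpleModule hξ (by omega) (by omega) (by omega),
    fun V W _ _ _ _ _ _ _ _ mv mw hV hW => ⟨?_, ?_⟩,
    fun k k' V W _ _ _ _ _ _ _ _ mv mw hV hW => ?_⟩
  · rintro ⟨f⟩
    exact hV.eq_and_modEq_of_equiv hξ h0 (by omega) (by omega) hW f
  · rintro ⟨rfl, hi⟩
    exact (hV.congr_modEq hξ h0 hi).nonempty_equiv hW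
  · rintro ⟨f⟩
    have h := (hV.eq_and_modEq_of_equiv hξ h0 (by omega) (by omega) hW f).2
    have hdvd : (n : ℤ) ∣ (l : ℤ) + (k' - k) * n := by
      have h1 := (Dvd.intro_left (m : ℤ) rfl).trans (Int.modEq_iff_dvd.1 h)
      rwa [show i + l + k' * n - (i + k * n) = (l : ℤ) + (k' - k) * n by ring] at h1
    have hl0 : n ∣ l := by
      exact_mod_cast (Int.dvd_add_left (Dvd.intro_left (k' - k) rfl)).1 hdvd
    have := Nat.le_of_dvd (by omega) hl0
    omega

end Radford
end
end
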